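/- There exists a constant c > 0 such that for every integer N ≥ 3 and all integers m, j with |m| ≤ 3N and |j| ≤ 3N², the number of pairs (n₁, n₂) ∈ ℤ² with |n₁| ≤ N, |n₂| ≤ N and n₁² + n₂² + (m − n₁ − n₂)² = j is at most exp(c · log N / log log N). -/

import Mathlib

lemma lcb_dvd {M X Y X' Y' X0 Y0 : ℤ} (hM : 0 < M)
    (h : X ^ 2 + 3 * Y ^ 2 = M) (hc : IsCoprime X Y)
    (h' : X' ^ 2 + 3 * Y' ^ 2 = M)
    (h0 : X0 ^ 2 + 3 * Y0 ^ 2 = M) (hc0 : IsCoprime X0 Y0)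
    (hd : Int.gcd (X * Y0 - X0 * Y) M = Int.gcd (X' * Y0 - X0 * Y') M) :
    M ∣ 12 * (X * Y' - X' * Y) := by
  have copM : ∀ {x y : ℤ}, x ^ 2 + 3 * y ^ 2 = M → IsCoprime x y → IsCoprime M y := by
    intro x y hxy hco
    rw [← hxy]
    have h1 : IsCoprime (x ^ 2) y := hco.pow_left
    have h2 : IsCoprime (x ^ 2 + (3 * y) * y) y := IsCoprime.add_mul_right_left h1 (3 * y)
    convert h2 using 2
    ring
  have hMY0 := copM h0 hc0
  have hMY := copM h hc
  have key : ∀ {x y : ℤ}, x ^ 2 + 3 * y ^ 2 = M → ∀ e : ℤ,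
      M = (Int.gcd (x * Y0 - X0 * y) M : ℤ) * e → e ∣ x * Y0 + X0 * y := by
    intro x y hxy e he
    have hMAB : M ∣ (x * Y0 - X0 * y) * (x * Y0 + X0 * y) := by
      refine ⟨Y0 ^ 2 - y ^ 2, ?_⟩
      linear_combination Y0 ^ 2 * hxy - y ^ 2 * h0
    have hbez := Int.gcd_eq_gcd_ab (x * Y0 - X0 * y) M
    set g : ℤ := (Int.gcd (x * Y0 - X0 * y) M : ℤ) with hg
    have hg0 : g ≠ 0 := by
      intro h; rw [h] at he; simp at he; omega
    have h1 : g * e ∣ g * (x * Y0 + X0 * y) := by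
      rw [← he]
      conv_rhs => rw [hbez]
      rw [add_mul]
      apply dvd_add
      · rw [mul_right_comm]; exact hMAB.mul_right _
      · rw [mul_assoc]; exact dvd_mul_right _ _
    exact (mul_dvd_mul_iff_left hg0).1 h1
  obtain ⟨e, he⟩ : (Int.gcd (X * Y0 - X0 * Y) M : ℤ) ∣ M := Int.gcd_dvd_right ..
  have heB := key h e he
  have heB' := key h' e (by rw [← hd]; exact he)
  have hdA : (Int.gcd (X * Y0 - X0 * Y) M : ℤ) ∣ X * Y0 - X0 * Y := Int.gcd_dvd_left ..
  have hdA' : (Int.gcd (X * Y0 - X0 * Y) M : ℤ) ∣ X' * Y0 - X0 * Y' := by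
    rw [hd]; exact Int.gcd_dvd_left ..
  set d : ℤ := (Int.gcd (X * Y0 - X0 * Y) M : ℤ)
  have hdM : d ∣ M := ⟨e, he⟩
  have heM : e ∣ M := ⟨d, by rw [he]; ring⟩
  have hdD : d ∣ X * Y' - X' * Y := by
    have : d ∣ Y0 * (X * Y' - X' * Y) := by
      rw [show Y0 * (X * Y' - X' * Y) =
        (X * Y0 - X0 * Y) * Y' - (X' * Y0 - X0 * Y') * Y by ring]
      exact dvd_sub (hdA.mul_right Y') (hdA'.mul_right Y)
    exact (hMY0.of_isCoprime_of_dvd_left hdM).dvd_of_dvd_mul_left this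
  have heD : e ∣ X * Y' - X' * Y := by
    have : e ∣ Y0 * (X * Y' - X' * Y) := by
      rw [show Y0 * (X * Y' - X' * Y) =
        (X * Y0 + X0 * Y) * Y' - (X' * Y0 + X0 * Y') * Y by ring]
      exact dvd_sub (heB.mul_right Y') (heB'.mul_right Y)
    exact (hMY0.of_isCoprime_of_dvd_left heM).dvd_of_dvd_mul_left this
  have hgd : (Int.gcd d e : ℤ) ∣ d := Int.gcd_dvd_left ..
  have hge : (Int.gcd d e : ℤ) ∣ e := Int.gcd_dvd_right ..
  have hbez := Int.gcd_eq_gcd_ab d e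
  set g : ℤ := (Int.gcd d e : ℤ)
  have hgM : g ∣ M := hgd.trans hdM
  have hg2X : g ∣ 2 * X := by
    have : g ∣ Y0 * (2 * X) := by
      rw [show Y0 * (2 * X) = (X * Y0 - X0 * Y) + (X * Y0 + X0 * Y) by ring]
      exact dvd_add (hgd.trans hdA) (hge.trans heB)
    exact (hMY0.of_isCoprime_of_dvd_left hgM).dvd_of_dvd_mul_left this
  have hg12 : g ∣ 12 := by
    have : g ∣ Y ^ 2 * 12 := by
      rw [show Y ^ 2 * 12 = 4 * M - 2 * X * (2 * X) by rw [← h]; ring]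
      exact dvd_sub (hgM.mul_left 4) (hg2X.mul_right (2 * X))
    exact ((hMY.of_isCoprime_of_dvd_left hgM).pow_right).dvd_of_dvd_mul_left this
  have hfin : M ∣ g * (X * Y' - X' * Y) := by
    rw [hbez, he, add_mul]
    apply dvd_add
    · rw [mul_assoc]; exact mul_dvd_mul_left _ (heD.mul_left _)
    · rw [mul_comm d e, mul_assoc]; exact mul_dvd_mul_left _ (hdD.mul_left _)
  exact hfin.trans (mul_dvd_mul_right hg12 _)

lemma lcb_prim (M : ℤ) (hM : 0 < M) (S : Finset (ℤ × ℤ))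
    (hS : ∀ p ∈ S, p.1 ^ 2 + 3 * p.2 ^ 2 = M ∧ IsCoprime p.1 p.2) :
    S.card ≤ 50 * M.natAbs.divisors.card := by
  classical
  rcases S.eq_empty_or_nonempty with rfl | ⟨⟨X0, Y0⟩, hp0⟩
  · simp
  obtain ⟨h0, hc0⟩ := hS _ hp0
  simp only at h0 hc0
  set f : ℤ × ℤ → ℕ := fun p => Int.gcd (p.1 * Y0 - X0 * p.2) M with hf
  have himg : S.image f ⊆ M.natAbs.divisors := by
    intro d hd
    obtain ⟨p, -, rfl⟩ := Finset.mem_image.1 hd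
    rw [Nat.mem_divisors]
    exact ⟨Nat.gcd_dvd_right _ _, by omega⟩
  refine (Finset.card_le_mul_card_image (f := f) S 50 ?_).trans
    (Nat.mul_le_mul_left _ (Finset.card_le_card himg))
  intro d _
  rcases (S.filter (fun x => f x = d)).eq_empty_or_nonempty with he | ⟨⟨X, Y⟩, hq⟩
  · rw [he]; simp
  obtain ⟨hqS, hqd⟩ := Finset.mem_filter.1 hq
  obtain ⟨h, hc⟩ := hS _ hqS
  simp only at h hc
  have hdv : ∀ p ∈ S.filter (fun x => f x = d), M ∣ 12 * (X * p.2 - p.1 * Y) := by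
    intro p hp
    obtain ⟨hpS, hpd⟩ := Finset.mem_filter.1 hp
    exact lcb_dvd hM h hc (hS p hpS).1 h0 hc0 (hqd.trans hpd.symm)
  have hnorm : ∀ p ∈ S.filter (fun x => f x = d),
      (X * p.1 + 3 * Y * p.2) ^ 2 + 3 * (X * p.2 - p.1 * Y) ^ 2 = M ^ 2 := by
    intro p hp
    have h2 := (hS p (Finset.mem_filter.1 hp).1).1
    linear_combination (p.1 ^ 2 + 3 * p.2 ^ 2) * h + M * h2
  have : 50 = ((Finset.Icc (-12 : ℤ) 12) ×ˢ (Finset.univ : Finset Bool)).card := by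
    simp
  rw [this]
  apply Finset.card_le_card_of_injOn
    (fun p => (12 * (X * p.2 - p.1 * Y) / M, decide (0 ≤ X * p.1 + 3 * Y * p.2)))
  · intro p hp
    have hn := hnorm p hp
    obtain ⟨k, hk⟩ := hdv p hp
    have hD : |X * p.2 - p.1 * Y| ≤ M := by
      refine abs_le_of_sq_le_sq ?_ hM.le
      nlinarith [sq_nonneg (X * p.1 + 3 * Y * p.2), sq_nonneg (X * p.2 - p.1 * Y)]
    rw [abs_le] at hD
    have : 12 * (X * p.2 - p.1 * Y) / M = k := by
      rw [hk]; exact Int.mul_ediv_cancel_left _ hM.ne'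
    simp only [Finset.coe_product, Set.mem_prod, Finset.mem_coe, Finset.mem_Icc, this,
      Finset.mem_univ, and_true]
    constructor <;> nlinarith
  · intro p hp q hq heq
    simp only [Prod.mk.injEq, decide_eq_decide] at heq
    obtain ⟨h1, h2⟩ := heq
    have hD : X * p.2 - p.1 * Y = X * q.2 - q.1 * Y := by
      have := (Int.ediv_left_inj (hdv p hp) (hdv q hq)).1 h1
      omega
    have hE : X * p.1 + 3 * Y * p.2 = X * q.1 + 3 * Y * q.2 := by
      have hn1 := hnorm p hp
      have hn2 := hnorm q hq
      rw [hD] at hn1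
      have : (X * p.1 + 3 * Y * p.2) ^ 2 = (X * q.1 + 3 * Y * q.2) ^ 2 := by linarith
      rcases sq_eq_sq_iff_eq_or_eq_neg.1 this with h | h
      · exact h
      · by_cases h3 : 0 ≤ X * p.1 + 3 * Y * p.2
        · have := h2.1 h3; omega
        · have := mt h2.2 h3; omega
    apply Prod.ext
    · apply mul_left_cancel₀ hM.ne'
      rw [← h]
      linear_combination X * hE - 3 * Y * hD
    · apply mul_left_cancel₀ hM.ne'
      rw [← h]
      linear_combination Y * hE + X * hD

lemma lcb_all (M : ℤ) (hM : 0 < M) (S : Finset (ℤ × ℤ))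
    (hS : ∀ p ∈ S, p.1 ^ 2 + 3 * p.2 ^ 2 = M) :
    S.card ≤ 50 * M.natAbs.divisors.card * M.natAbs.divisors.card := by
  classical
  set f : ℤ × ℤ → ℕ := fun p => Int.gcd p.1 p.2 with hf
  have hsq : ∀ p ∈ S, ((f p : ℤ)) ^ 2 ∣ M := by
    intro p hp
    rw [← hS p hp]
    have h1 : (f p : ℤ) ∣ p.1 := Int.gcd_dvd_left ..
    have h2 : (f p : ℤ) ∣ p.2 := Int.gcd_dvd_right ..
    exact dvd_add (pow_dvd_pow_of_dvd h1 2) ((pow_dvd_pow_of_dvd h2 2).mul_left 3)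
  have himg : S.image f ⊆ M.natAbs.divisors := by
    intro d hd
    obtain ⟨p, hp, rfl⟩ := Finset.mem_image.1 hd
    rw [Nat.mem_divisors]
    refine ⟨?_, by omega⟩
    rw [← Int.natCast_dvd]
    exact (dvd_pow_self _ two_ne_zero).trans (hsq p hp)
  refine (Finset.card_le_mul_card_image (f := f) S (50 * M.natAbs.divisors.card) ?_).trans
    (Nat.mul_le_mul_left _ (Finset.card_le_card himg))
  intro d hd
  obtain ⟨p0, hp0, rfl⟩ := Finset.mem_image.1 hd
  obtain ⟨M', hM'⟩ := hsq p0 hp0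
  set g : ℤ := (f p0 : ℤ) with hg
  have hg0 : 0 < g := by
    have : 0 ≤ g := by positivity
    rcases this.eq_or_lt with h | h
    · rw [← h] at hM'; simp at hM'; omega
    · exact h
  have hM'0 : 0 < M' := by
    by_contra hcon
    nlinarith [sq_nonneg g]
  have hdvd : ∀ p ∈ S.filter (fun x => f x = f p0), p.1 = g * (p.1 / g) ∧ p.2 = g * (p.2 / g) := by
    intro p hp
    have hpd := (Finset.mem_filter.1 hp).2
    have h1 : (f p : ℤ) ∣ p.1 := Int.gcd_dvd_left ..
    have h2 : (f p : ℤ) ∣ p.2 := Int.gcd_dvd_right ..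
    rw [hpd] at h1 h2
    exact ⟨(Int.mul_ediv_cancel' h1).symm, (Int.mul_ediv_cancel' h2).symm⟩
  have hinj : Set.InjOn (fun p : ℤ × ℤ => (p.1 / g, p.2 / g))
      (S.filter (fun x => f x = f p0) : Set (ℤ × ℤ)) := by
    intro p hp q hq heq
    have hp' := hdvd p (by simpa using hp)
    have hq' := hdvd q (by simpa using hq)
    simp only [Prod.mk.injEq] at heq
    apply Prod.ext
    · rw [hp'.1, hq'.1, heq.1]
    · rw [hp'.2, hq'.2, heq.2]
  have hinj' : Set.InjOn (fun p : ℤ × ℤ => (p.1 / g, p.2 / g))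
      ((S.filter (fun x => f x = f p0) : Finset (ℤ × ℤ)) : Set (ℤ × ℤ)) := by
    intro p hp q hq heq
    exact hinj (by simpa using hp) (by simpa using hq) heq
  rw [← Finset.card_image_of_injOn hinj']
  refine (lcb_prim M' hM'0 _ ?_).trans ?_
  · intro q hq
    obtain ⟨p, hp, rfl⟩ := Finset.mem_image.1 hq
    obtain ⟨h1, h2⟩ := hdvd p hp
    have hpS := (Finset.mem_filter.1 hp).1
    have hpd := (Finset.mem_filter.1 hp).2
    constructor
    · have := hS p hpS
      rw [hM', h1, h2] at this
      apply mul_left_cancel₀ (pow_ne_zero 2 hg0.ne')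
      simp only
      linear_combination this
    · simp only
      rw [Int.isCoprime_iff_gcd_eq_one]
      have h3 : Int.gcd (g * (p.1 / g)) (g * (p.2 / g)) = f p0 := by
        rw [← h1, ← h2]; exact hpd
      rw [Int.gcd_mul_left, hg, Int.natAbs_natCast] at h3
      have : 0 < f p0 := Int.natCast_pos.1 hg0
      exact Nat.eq_of_mul_eq_mul_left this (by rw [mul_one]; exact h3)
  · apply Nat.mul_le_mul_left
    apply Finset.card_le_card
    apply Nat.divisors_subset_of_dvd (by omega)
    rw [Int.natAbs_dvd_natAbs]
    exact ⟨g ^ 2, by rw [hM']; ring⟩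

lemma lcb_div (M : ℕ) (hM : M ≠ 0) (x : ℝ) (hx : 1 < x) (hMx : Real.log M ≤ 5 * x) :
    (M.divisors.card : ℝ) ≤ Real.exp (26 * (x / Real.log x)) := by
  classical
  set l := Real.log x with hl
  have hl0 : 0 < l := Real.log_pos hx
  have hx0 : 0 < x := by linarith
  have hexpl : Real.exp l = x := Real.exp_log hx0
  set T := Real.sqrt x with hT
  have hTT : Real.exp (l / 2) = T := by
    rw [hT, Real.sqrt_eq_rpow, Real.rpow_def_of_pos hx0]; congr 1; rw [← hl]; ring
  have hfac : ∀ p ∈ M.primeFactors, ((M.factorization p + 1 : ℕ) : ℝ) ≤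
      (if (p : ℝ) < T then x else 1) *
        Real.exp (2 / l * (M.factorization p * Real.log p)) := by
    intro p hp
    have hp2 : (2 : ℝ) ≤ p := by exact_mod_cast (Nat.prime_of_mem_primeFactors hp).two_le
    set a := M.factorization p
    have ha : (0 : ℝ) ≤ a := by positivity
    push_cast
    have hlp : 1 / 2 ≤ Real.log p :=
      le_trans (by linarith [Real.log_two_gt_d9]) (Real.log_le_log (by norm_num) hp2)
    split_ifs with h
    · set E := Real.exp (2 / l * (a * Real.log p)) with hE
      have h1 : 2 / l * (a * Real.log p) + 1 ≤ E := Real.add_one_le_exp _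
      have h2 : (a : ℝ) / l ≤ 2 / l * (a * Real.log p) := by
        rw [div_mul_eq_mul_div]
        apply div_le_div_of_nonneg_right _ hl0.le
        nlinarith
      have h3 : (a : ℝ) ≤ l * (E - 1) := by
        have : (a : ℝ) / l ≤ E - 1 := by linarith
        rw [div_le_iff₀ hl0] at this; linarith
      have h4 : l + 1 ≤ x := by rw [← hexpl]; exact Real.add_one_le_exp _
      have hE1 : 1 ≤ E := by
        have : 0 ≤ (a : ℝ) / l := by positivity
        linarith
      nlinarith
    · push Not at h
      rw [one_mul]
      have h1 : l / 2 ≤ Real.log p := by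
        rw [Real.le_log_iff_exp_le (by linarith), hTT]; exact h
      have h2 : (a : ℝ) ≤ 2 / l * (a * Real.log p) := by
        rw [div_mul_eq_mul_div, le_div_iff₀ hl0]
        nlinarith
      linarith [Real.add_one_le_exp (2 / l * (a * Real.log p))]
  have hlogM : ∑ p ∈ M.primeFactors, (M.factorization p * Real.log p) = Real.log M := by
    rw [Real.log_nat_eq_sum_factorization]; rfl
  have hcard : (((M.primeFactors.filter (fun p : ℕ => (p : ℝ) < T)).card : ℕ) : ℝ) ≤ T := by
    have hsub : (M.primeFactors.filter (fun p : ℕ => (p : ℝ) < T)) ⊆ Finset.Icc 1 ⌊T⌋₊ := by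
      intro p hp
      obtain ⟨h1, h2⟩ := Finset.mem_filter.1 hp
      rw [Finset.mem_Icc]
      exact ⟨(Nat.prime_of_mem_primeFactors h1).one_lt.le, Nat.le_floor h2.le⟩
    have := Finset.card_le_card hsub
    rw [Nat.card_Icc, Nat.add_sub_cancel] at this
    calc _ ≤ ((⌊T⌋₊ : ℕ) : ℝ) := by exact_mod_cast this
      _ ≤ T := Nat.floor_le (Real.sqrt_nonneg _)
  have hprod : (M.divisors.card : ℝ) ≤ x ^ (M.primeFactors.filter (fun p : ℕ => (p : ℝ) < T)).card
      * Real.exp (2 / l * Real.log M) := by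
    rw [Nat.card_divisors hM, Nat.cast_prod]
    refine (Finset.prod_le_prod (fun _ _ => by positivity) hfac).trans (le_of_eq ?_)
    rw [Finset.prod_mul_distrib, ← Real.exp_sum, ← Finset.mul_sum, hlogM, Finset.prod_ite]
    simp
  have hpow : x ^ (M.primeFactors.filter (fun p : ℕ => (p : ℝ) < T)).card ≤ Real.exp (T * l) := by
    conv_lhs => rw [← hexpl]
    rw [← Real.exp_nat_mul]
    apply Real.exp_le_exp.2
    exact mul_le_mul_of_nonneg_right hcard hl0.le
  calc (M.divisors.card : ℝ) ≤ _ := hprod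
    _ ≤ Real.exp (T * l) * Real.exp (2 / l * Real.log M) :=
      mul_le_mul_of_nonneg_right hpow (Real.exp_pos _).le
    _ = Real.exp (T * l + 2 / l * Real.log M) := (Real.exp_add _ _).symm
    _ ≤ _ := by
      apply Real.exp_le_exp.2
      have h1 : 2 / l * Real.log M ≤ 10 * (x / l) := by
        calc 2 / l * Real.log M ≤ 2 / l * (5 * x) := by gcongr
          _ = _ := by ring
      have h2 : T * l ≤ 16 * (x / l) := by
        rw [← mul_div_assoc, le_div_iff₀ hl0]
        have h3 : l / 4 + 1 ≤ Real.exp (l / 4) := Real.add_one_le_exp _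
        have h4 : Real.exp (l / 4) * Real.exp (l / 4) = T := by
          rw [← Real.exp_add, ← hTT]; congr 1; ring
        have h5 : T * T = x := Real.mul_self_sqrt hx0.le
        have h6 : l * l ≤ 16 * T := by nlinarith
        have h7 : 0 ≤ T := Real.sqrt_nonneg _
        calc T * l * l = T * (l * l) := by ring
          _ ≤ T * (16 * T) := mul_le_mul_of_nonneg_left h6 h7
          _ = 16 * x := by rw [← h5]; ring
      linarith

/-- There is `c > 0` such that for every `N ≥ 3` and all `|m| ≤ 3N`, `|j| ≤ 3N²`, the number of
pairs `(n₁,n₂)` with `|n₁| ≤ N`, `|n₂| ≤ N` and `n₁² + n₂² + (m − n₁ − n₂)² = j` is at most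
`exp(c log N / log log N)`. -/
theorem lattice_count_bound :
    ∃ c > (0 : ℝ), ∀ N : ℕ, 3 ≤ N → ∀ m j : ℤ, |m| ≤ 3 * N → |j| ≤ 3 * (N : ℤ) ^ 2 →
      (Set.ncard {p : ℤ × ℤ |
          |p.1| ≤ (N : ℤ) ∧ |p.2| ≤ (N : ℤ) ∧
          p.1 ^ 2 + p.2 ^ 2 + (m - p.1 - p.2) ^ 2 = j} : ℝ)
        ≤ Real.exp (c * Real.log N / Real.log (Real.log N)) := by
  classical
  refine ⟨56, by norm_num, ?_⟩
  intro N hN m j _ hj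
  set A := {p : ℤ × ℤ | |p.1| ≤ (N : ℤ) ∧ |p.2| ≤ (N : ℤ) ∧
          p.1 ^ 2 + p.2 ^ 2 + (m - p.1 - p.2) ^ 2 = j} with hA
  have hN3 : (3 : ℝ) ≤ N := by exact_mod_cast hN
  have hx : 1 < Real.log N := by
    rw [Real.lt_log_iff_exp_lt (by linarith)]
    linarith [Real.exp_one_lt_d9]
  have hl0 : 0 < Real.log (Real.log N) := Real.log_pos hx
  set x := Real.log N with hxdef
  have hxl : 1 ≤ x / Real.log x := by
    rw [le_div_iff₀ hl0, one_mul]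
    linarith [Real.log_le_sub_one_of_pos (show 0 < x by linarith)]
  have hfin : A.Finite := by
    apply (Set.finite_Icc ((-N : ℤ), (-N : ℤ)) ((N : ℤ), (N : ℤ))).subset
    rintro p ⟨h1, h2, -⟩
    rw [abs_le] at h1 h2
    exact ⟨⟨h1.1, h2.1⟩, ⟨h1.2, h2.2⟩⟩
  rw [Set.ncard_eq_toFinset_card A hfin]
  set φ : ℤ × ℤ → ℤ × ℤ := fun p => (3 * (p.1 + p.2) - 2 * m, p.1 - p.2) with hφ
  have hφi : Function.Injective φ := by
    intro p q h
    simp only [hφ, Prod.mk.injEq] at h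
    apply Prod.ext <;> omega
  set S := hfin.toFinset.image φ with hSdef
  have hcard : hfin.toFinset.card = S.card := (Finset.card_image_of_injective _ hφi).symm
  rw [hcard]
  have hS : ∀ p ∈ S, p.1 ^ 2 + 3 * p.2 ^ 2 = 6 * j - 2 * m ^ 2 := by
    intro q hq
    obtain ⟨p, hp, rfl⟩ := Finset.mem_image.1 hq
    have h3 := ((Set.Finite.mem_toFinset hfin).1 hp).2.2
    simp only [hφ]
    linear_combination 6 * h3
  have h1exp : (1 : ℝ) ≤ Real.exp (56 * x / Real.log x) := by
    apply Real.one_le_exp; rw [mul_div_assoc]; linarith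
  rcases lt_or_ge 0 (6 * j - 2 * m ^ 2) with hM | hM
  · have hall := lcb_all _ hM S hS
    set M := 6 * j - 2 * m ^ 2 with hMdef
    have hMle : M.natAbs ≤ N ^ 5 := by
      zify
      rw [abs_of_pos hM]
      have h1 : M ≤ 18 * (N : ℤ) ^ 2 := by
        rw [abs_le] at hj
        nlinarith [sq_nonneg m]
      have h2 : (27 : ℤ) ≤ (N : ℤ) ^ 3 := by
        calc (27 : ℤ) = 3 ^ 3 := by norm_num
          _ ≤ (N : ℤ) ^ 3 := by gcongr; exact_mod_cast hN
      calc M ≤ 18 * (N : ℤ) ^ 2 := h1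
        _ ≤ (N : ℤ) ^ 3 * (N : ℤ) ^ 2 := by gcongr; linarith
        _ = _ := by ring
    have hM0 : M.natAbs ≠ 0 := by omega
    have hlog : Real.log (M.natAbs : ℝ) ≤ 5 * x := by
      have : Real.log (M.natAbs : ℝ) ≤ Real.log ((N : ℝ) ^ 5) := by
        apply Real.log_le_log
        · exact_mod_cast Nat.pos_of_ne_zero hM0
        · exact_mod_cast hMle
      rw [Real.log_pow] at this
      exact_mod_cast this
    have hd := lcb_div M.natAbs hM0 x hx hlog
    have h50 : (50 : ℝ) ≤ Real.exp 4 := by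
      have h := Real.exp_one_gt_d9
      have : Real.exp 4 = Real.exp 1 ^ 4 := by rw [← Real.exp_nat_mul]; norm_num
      rw [this]
      calc (50 : ℝ) ≤ 2.7 ^ 4 := by norm_num
        _ ≤ _ := by gcongr; linarith
    calc (S.card : ℝ) ≤ 50 * (M.natAbs.divisors.card : ℝ) * (M.natAbs.divisors.card : ℝ) := by
          exact_mod_cast hall
      _ ≤ Real.exp 4 * Real.exp (26 * (x / Real.log x)) * Real.exp (26 * (x / Real.log x)) := by
          gcongr
      _ = Real.exp (4 + 26 * (x / Real.log x) + 26 * (x / Real.log x)) := by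
          rw [Real.exp_add, Real.exp_add]
      _ ≤ _ := by
          apply Real.exp_le_exp.2
          rw [mul_div_assoc]; linarith
  · have hle : S.card ≤ 1 := by
      rw [Finset.card_le_one]
      have hz : ∀ p ∈ S, p = (0, 0) := by
        intro p hp
        have h := hS p hp
        have h1 : p.1 ^ 2 = 0 := by nlinarith [sq_nonneg p.1, sq_nonneg p.2]
        have h2 : p.2 ^ 2 = 0 := by nlinarith [sq_nonneg p.1, sq_nonneg p.2]
        exact Prod.ext (pow_eq_zero_iff two_ne_zero |>.1 h1) (pow_eq_zero_iff two_ne_zero |>.1 h2)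
      intro p hp q hq
      rw [hz p hp, hz q hq]
    calc (S.card : ℝ) ≤ 1 := by exact_mod_cast hle
      _ ≤ _ := h1exp
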